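/- arXiv:1802.02908 — 5 statements merged into one kernel-verified Lean document; each statement's English description precedes it below -/
import Mathlib

section
/- For every integer n ≥ 2 and every real number μ with μ ≥ n−1 and μ > 0, there exists a constant C > 0 such that for all real numbers φ and ψ one has (1/2)(μ−(n−1))²·φ² − 4(μ−(n−1))·φψ + (2μ+2n+6)·ψ² ≥ C·((1/2)(μ−(n−1))·φ² + 2ψ²). -/
/-- Strict positivity of the tangential operator of the Lichnerowicz Laplacian on the
subspaces `V_{3,i}`: for every integer `n ≥ 2` and real `μ ≥ n − 1` with `μ > 0`, there is
`C > 0` such that for all `φ ψ : ℝ`,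
`(1/2)(μ−(n−1))²φ² − 4(μ−(n−1))φψ + (2μ+2n+6)ψ² ≥ C·((1/2)(μ−(n−1))φ² + 2ψ²)`. -/
theorem stmt0 (n : ℤ) (hn : 2 ≤ n) (μ : ℝ) (hμ1 : (n : ℝ) - 1 ≤ μ) (hμ2 : 0 < μ) :
    ∃ C : ℝ, 0 < C ∧ ∀ φ ψ : ℝ,
      (1 / 2) * (μ - ((n : ℝ) - 1)) ^ 2 * φ ^ 2 - 4 * (μ - ((n : ℝ) - 1)) * (φ * ψ)
          + (2 * μ + 2 * (n : ℝ) + 6) * ψ ^ 2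
        ≥ C * ((1 / 2) * (μ - ((n : ℝ) - 1)) * φ ^ 2 + 2 * ψ ^ 2) := by
  have hn' : (2 : ℝ) ≤ n := by exact_mod_cast hn
  obtain ⟨a, ha⟩ : ∃ a : ℝ, a = μ - ((n : ℝ) - 1) := ⟨_, rfl⟩
  have ha0 : 0 ≤ a := by linarith
  have hμ : 2 * μ + 2 * (n : ℝ) + 6 = 2 * a + 4 * n + 4 := by linarith
  rw [← ha, hμ]
  rcases ha0.eq_or_lt with h | h
  · refine ⟨1, one_pos, fun φ ψ => ?_⟩
    subst h
    nlinarith [mul_nonneg (by linarith : (0 : ℝ) ≤ n) (sq_nonneg ψ), sq_nonneg ψ]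
  · refine ⟨a / 8, by positivity, fun φ ψ => ?_⟩
    -- Completing the square with `7 * (a * φ) - 32 * ψ` leaves a nonnegative multiple of `ψ ^ 2`.
    have hψ : 0 ≤ (n - 2 : ℝ) * ψ ^ 2 := mul_nonneg (by linarith) (sq_nonneg ψ)
    have haψ : 0 ≤ a * ψ ^ 2 := by positivity
    nlinarith [sq_nonneg (7 * (a * φ) - 32 * ψ), sq_nonneg ψ]
end

section
/- For every natural number n and every real number λ, the determinant of the symmetric 2×2 real matrix with entries b₁₁ = 2λ(λ+4), b₂₂ = n((n+1)λ + 2(n+1)²), and b₁₂ = b₂₁ = 4(n+1)λ equals λ·(2n(n+1)λ² + 4(n+1)(n²−n−4)λ + 16n(n+1)²). Moreover, for every integer n ≥ 2 and every real λ > 0 this matrix is positive definite. -/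
/-- Sylvester's criterion for real symmetric `2 × 2` matrices. -/
theorem posDef_fin_two_of_pos_of_det_pos {a b c : ℝ} (ha : 0 < a)
    (hdet : 0 < (!![a, b; b, c]).det) : (!![a, b; b, c]).PosDef := by
  rw [Matrix.det_fin_two_of] at hdet
  refine Matrix.PosDef.of_dotProduct_mulVec_pos ?_ fun x hx => ?_
  · ext i j
    fin_cases i <;> fin_cases j <;> simp
  · have hform : dotProduct (star x) (Matrix.mulVec !![a, b; b, c] x)
        = ((a * x 0 + b * x 1) ^ 2 + (a * c - b * b) * x 1 ^ 2) / a := by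
      simp [Matrix.mulVec, dotProduct, Fin.sum_univ_two]
      field_simp
      ring
    rw [hform]
    refine div_pos ?_ ha
    rcases eq_or_ne (x 1) 0 with h1 | h1
    · have h0 : x 0 ≠ 0 := fun h0 => hx (by ext i; fin_cases i <;> simp [h0, h1])
      simp only [h1, mul_zero, add_zero, ne_eq, OfNat.ofNat_ne_zero, not_false_eq_true, zero_pow]
      positivity
    · positivity

/-- Determinant formula and positive definiteness of the lower-right principal minor `A₂₃`
(at `ε = 0`) of the matrix representing `□_L` on the subspace `V₄`. -/
theorem stmt2 :
    (∀ (n : ℕ) (l : ℝ),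
      (!![2 * l * (l + 4), 4 * ((n : ℝ) + 1) * l;
          4 * ((n : ℝ) + 1) * l, (n : ℝ) * (((n : ℝ) + 1) * l + 2 * ((n : ℝ) + 1) ^ 2)]).det
        = l * (2 * (n : ℝ) * ((n : ℝ) + 1) * l ^ 2
            + 4 * ((n : ℝ) + 1) * ((n : ℝ) ^ 2 - (n : ℝ) - 4) * l
            + 16 * (n : ℝ) * ((n : ℝ) + 1) ^ 2)) ∧
    (∀ (n : ℕ), 2 ≤ n → ∀ l : ℝ, 0 < l →
      (!![2 * l * (l + 4), 4 * ((n : ℝ) + 1) * l;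
          4 * ((n : ℝ) + 1) * l,
          (n : ℝ) * (((n : ℝ) + 1) * l + 2 * ((n : ℝ) + 1) ^ 2)]).PosDef) := by
  have hdet : ∀ (n : ℕ) (l : ℝ),
      (!![2 * l * (l + 4), 4 * ((n : ℝ) + 1) * l;
          4 * ((n : ℝ) + 1) * l, (n : ℝ) * (((n : ℝ) + 1) * l + 2 * ((n : ℝ) + 1) ^ 2)]).det
        = l * (2 * (n : ℝ) * ((n : ℝ) + 1) * l ^ 2
            + 4 * ((n : ℝ) + 1) * ((n : ℝ) ^ 2 - (n : ℝ) - 4) * l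
            + 16 * (n : ℝ) * ((n : ℝ) + 1) ^ 2) := fun n l => by
    rw [Matrix.det_fin_two_of]
    ring
  refine ⟨hdet, fun n hn l hl => posDef_fin_two_of_pos_of_det_pos (by positivity) ?_⟩
  rw [hdet]
  have hn' : (2 : ℝ) ≤ n := by exact_mod_cast hn
  have hquad : 0 < 2 * (n : ℝ) * l ^ 2 + 4 * ((n : ℝ) ^ 2 - n - 4) * l
      + 16 * n * ((n : ℝ) + 1) := by
    have hlin : -2 * l ≤ ((n : ℝ) ^ 2 - n - 4) * l :=
      mul_le_mul_of_nonneg_right (by nlinarith) hl.le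
    have hsq : 2 * l ^ 2 ≤ n * l ^ 2 := mul_le_mul_of_nonneg_right hn' (sq_nonneg l)
    nlinarith [sq_nonneg (l - 1)]
  have hpos : 0 < l * (((n : ℝ) + 1) * (2 * (n : ℝ) * l ^ 2 + 4 * ((n : ℝ) ^ 2 - n - 4) * l
      + 16 * n * ((n : ℝ) + 1))) := by positivity
  linarith
end

section
/- For every natural number n and every real number λ, the determinant of the symmetric 3×3 real matrix A(n,λ) with entries a₁₁ = n(n−1)λ(λ−n)(λ−2(n−1)), a₂₂ = 2λ(λ+4), a₃₃ = n((n+1)λ + 2(n+1)²), a₁₂ = a₂₁ = −4(n−1)λ(λ−n), a₂₃ = a₃₂ = 4(n+1)λ, and a₁₃ = a₃₁ = 0 equals 2n²(n²−1)·λ³·(λ−n)·(λ−(2n+2))·(λ+2n−6). -/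
/-- The determinant factorization of the 3×3 matrix `A(n,λ)` through which the tangential
operator `□_L` acts on the scalar-eigenfunction subspace `V₄`. -/
theorem stmt3 (n : ℕ) (l : ℝ) :
    (!![(n : ℝ) * ((n : ℝ) - 1) * l * (l - (n : ℝ)) * (l - 2 * ((n : ℝ) - 1)),
        -4 * ((n : ℝ) - 1) * l * (l - (n : ℝ)), 0;
        -4 * ((n : ℝ) - 1) * l * (l - (n : ℝ)), 2 * l * (l + 4), 4 * ((n : ℝ) + 1) * l;
        0, 4 * ((n : ℝ) + 1) * l,
        (n : ℝ) * (((n : ℝ) + 1) * l + 2 * ((n : ℝ) + 1) ^ 2)]).det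
      = 2 * (n : ℝ) ^ 2 * ((n : ℝ) ^ 2 - 1) * l ^ 3 * (l - (n : ℝ))
          * (l - (2 * (n : ℝ) + 2)) * (l + 2 * (n : ℝ) - 6) := by
  rw [Matrix.det_fin_three]
  simp only [Matrix.of_apply, Matrix.cons_val]
  ring
end

section
/- For every integer n ≥ 2 and every real number λ > n, the symmetric 3×3 real matrix A(n,λ) with entries a₁₁ = n(n−1)λ(λ−n)(λ−2(n−1)), a₂₂ = 2λ(λ+4), a₃₃ = n((n+1)λ + 2(n+1)²), a₁₂ = a₂₁ = −4(n−1)λ(λ−n), a₂₃ = a₃₂ = 4(n+1)λ, and a₁₃ = a₃₁ = 0 is positive definite if and only if λ > 2n+2; moreover, for λ = 2n+2 the matrix A(n,λ) is positive semidefinite. -/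
open Matrix in
/-- A symmetric tridiagonal real `3 × 3` matrix with positive corner entries and nonnegative
determinant is positive semidefinite. -/
lemma Matrix.posSemidef_tridiagonal_fin_three {a b c d e : ℝ} (ha : 0 < a) (he : 0 < e)
    (hdet : 0 ≤ (!![a, b, 0; b, c, d; 0, d, e]).det) :
    (!![a, b, 0; b, c, d; 0, d, e]).PosSemidef := by
  refine .of_dotProduct_mulVec_nonneg ?_ fun x => ?_
  · ext i j
    fin_cases i <;> fin_cases j <;> simp
  · refine (mul_nonneg_iff_of_pos_left (mul_pos ha he)).mp ?_
    have key : a * e * (star x ⬝ᵥ (!![a, b, 0; b, c, d; 0, d, e] *ᵥ x)) =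
        e * (a * x 0 + b * x 1) ^ 2 + a * (e * x 2 + d * x 1) ^ 2 +
          (!![a, b, 0; b, c, d; 0, d, e]).det * x 1 ^ 2 := by
      simp [det_fin_three, dotProduct, mulVec, Fin.sum_univ_three]
      ring
    rw [key]
    positivity


/-- For `n ≥ 2` and `λ > n`, the matrix `A(n,λ)` is positive definite iff `λ > 2n+2`,
and for `λ = 2n+2` it is positive semidefinite. -/
theorem stmt4 (n : ℤ) (hn : 2 ≤ n) (l : ℝ) (hl : (n : ℝ) < l) :
    ((!![(n : ℝ) * ((n : ℝ) - 1) * l * (l - (n : ℝ)) * (l - 2 * ((n : ℝ) - 1)),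
        -4 * ((n : ℝ) - 1) * l * (l - (n : ℝ)), 0;
        -4 * ((n : ℝ) - 1) * l * (l - (n : ℝ)), 2 * l * (l + 4), 4 * ((n : ℝ) + 1) * l;
        0, 4 * ((n : ℝ) + 1) * l,
        (n : ℝ) * (((n : ℝ) + 1) * l + 2 * ((n : ℝ) + 1) ^ 2)]).PosDef
      ↔ 2 * (n : ℝ) + 2 < l) ∧
    (l = 2 * (n : ℝ) + 2 →
      (!![(n : ℝ) * ((n : ℝ) - 1) * l * (l - (n : ℝ)) * (l - 2 * ((n : ℝ) - 1)),
        -4 * ((n : ℝ) - 1) * l * (l - (n : ℝ)), 0;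
        -4 * ((n : ℝ) - 1) * l * (l - (n : ℝ)), 2 * l * (l + 4), 4 * ((n : ℝ) + 1) * l;
        0, 4 * ((n : ℝ) + 1) * l,
        (n : ℝ) * (((n : ℝ) + 1) * l + 2 * ((n : ℝ) + 1) ^ 2)]).PosSemidef) := by
  have hn' : (2 : ℝ) ≤ n := by exact_mod_cast hn
  have hl0 : 0 < l := by linarith
  have hln : 0 < l - n := sub_pos.mpr hl
  have hn1 : 0 < (n : ℝ) - 1 := by linarith
  have hn0 : 0 < (n : ℝ) := by linarith
  set a : ℝ := (n : ℝ) * ((n : ℝ) - 1) * l * (l - (n : ℝ)) * (l - 2 * ((n : ℝ) - 1)) with ha_def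
  set b : ℝ := -4 * ((n : ℝ) - 1) * l * (l - (n : ℝ)) with hb_def
  set c : ℝ := 2 * l * (l + 4) with hc_def
  set d : ℝ := 4 * ((n : ℝ) + 1) * l with hd_def
  set e : ℝ := (n : ℝ) * (((n : ℝ) + 1) * l + 2 * ((n : ℝ) + 1) ^ 2) with he_def
  set k : ℝ := 2 * n ^ 2 * (n - 1) * (n + 1) * l ^ 3 * (l - n) * (l + 2 * n - 6) with hk_def
  have hdet : (!![a, b, 0; b, c, d; 0, d, e]).det = k * (l - (2 * n + 2)) := by
    simp [Matrix.det_fin_three, ha_def, hb_def, hc_def, hd_def, he_def, hk_def]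
    ring
  have hk : 0 < k := by
    have : 0 < l + 2 * n - 6 := by linarith
    positivity
  have he : 0 < e := by positivity
  have hpsd (h : 2 * (n : ℝ) + 2 ≤ l) : (!![a, b, 0; b, c, d; 0, d, e]).PosSemidef := by
    have h2 : 0 < l - 2 * ((n : ℝ) - 1) := by linarith
    refine Matrix.posSemidef_tridiagonal_fin_three (by positivity) he ?_
    rw [hdet]
    exact mul_nonneg hk.le (sub_nonneg.mpr h)
  refine ⟨⟨fun h => ?_, fun h => ?_⟩, fun h => hpsd h.ge⟩
  · have hpos := h.det_pos
    rw [hdet] at hpos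
    exact sub_pos.mp (pos_of_mul_pos_right hpos hk.le)
  · rw [(hpsd h.le).posDef_iff_det_ne_zero, hdet]
    exact (mul_pos hk (sub_pos.mpr h)).ne'
end

section
/- There exists ε₀ > 0 such that for every real ε with 0 ≤ ε ≤ ε₀, every integer n ≥ 2, and every real λ > 0, the symmetric 2×2 real matrix with entries b₁₁ = 2λ(λ+4−ε), b₂₂ = n(n+1)(λ + 2(n+1) − ε), and b₁₂ = b₂₁ = 4(n+1)λ is positive definite. -/
/-- A real symmetric 2×2 matrix with positive upper-left entry and positive determinant is
positive definite. -/
lemma posDef_fin_two_of_pos {a b c : ℝ} (ha : 0 < a) (hdet : 0 < a * c - b ^ 2) :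
    (!![a, b; b, c]).PosDef := by
  refine Matrix.PosDef.of_dotProduct_mulVec_pos ?_ fun x hx => ?_
  · ext i j
    fin_cases i <;> fin_cases j <;> simp
  · have hquad : 0 < a * x 0 ^ 2 + 2 * b * x 0 * x 1 + c * x 1 ^ 2 := by
      refine pos_of_mul_pos_right (a := a) ?_ ha.le
      rw [show a * (a * x 0 ^ 2 + 2 * b * x 0 * x 1 + c * x 1 ^ 2)
        = (a * x 0 + b * x 1) ^ 2 + (a * c - b ^ 2) * x 1 ^ 2 by ring]
      by_cases h1 : x 1 = 0
      · have h0 : x 0 ≠ 0 := fun h0 => hx <| by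
          ext i
          fin_cases i <;> simp [h0, h1]
        simp only [h1, mul_zero, add_zero, ne_eq, OfNat.ofNat_ne_zero, not_false_eq_true, zero_pow]
        positivity
      · positivity
    simp only [Matrix.mulVec, dotProduct, Fin.sum_univ_two, Pi.star_apply, star_trivial,
      Matrix.of_apply, Matrix.cons_val_zero, Matrix.cons_val_one]
    linarith

/-- There is `ε₀ > 0` such that for all `0 ≤ ε ≤ ε₀`, all integers `n ≥ 2` and all `λ > 0`,
the perturbed lower-right principal minor `A₂₃` of `□_L − εI` is positive definite. -/
theorem stmt5 :
    ∃ ε₀ : ℝ, 0 < ε₀ ∧ ∀ ε : ℝ, 0 ≤ ε → ε ≤ ε₀ → ∀ n : ℤ, 2 ≤ n → ∀ l : ℝ, 0 < l →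
      (!![2 * l * (l + 4 - ε), 4 * ((n : ℝ) + 1) * l;
          4 * ((n : ℝ) + 1) * l,
          (n : ℝ) * ((n : ℝ) + 1) * (l + 2 * ((n : ℝ) + 1) - ε)]).PosDef := by
  refine ⟨1, one_pos, fun ε _ hε n hn l hl => ?_⟩
  have hn' : (2 : ℝ) ≤ n := by exact_mod_cast hn
  generalize (n : ℝ) = n at hn'
  have hn0 : 0 < n := by linarith
  refine posDef_fin_two_of_pos (mul_pos (by linarith) (by linarith)) ?_
  have hmul : (l + 3) * (l + 2 * n + 1) ≤ (l + 4 - ε) * (l + 2 * (n + 1) - ε) :=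
    mul_le_mul (by linarith) (by linarith) (by linarith) (by linarith)
  have hpoly : 0 < n * ((l + 3) * (l + 2 * n + 1)) - 8 * (n + 1) * l := by
    obtain ⟨m, rfl⟩ : ∃ m, n = m + 2 := ⟨n - 2, by ring⟩
    have hm : 0 ≤ m := by linarith
    have h : 0 ≤ m * l ^ 2 + (2 * m ^ 2 + 4 * m) * l + 6 * m ^ 2 + 27 * m := by positivity
    linarith [sq_nonneg (l - 2)]
  have key : 0 < n * ((l + 4 - ε) * (l + 2 * (n + 1) - ε)) - 8 * (n + 1) * l :=
    hpoly.trans_le (sub_le_sub_right (mul_le_mul_of_nonneg_left hmul hn0.le) _)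
  have hfac : 0 < 2 * l * (n + 1) := by positivity
  linarith [mul_pos hfac key]
end
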